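/- arXiv:2603.12879 — 2 statements merged into one kernel-verified Lean document; each statement's English description precedes it below -/
import Mathlib

section
/- Let p be a prime, d ≥ 1, R = ℤ/p^dℤ, and let G = ℤ/p^{d₁}ℤ × ⋯ × ℤ/p^{d_r}ℤ with d ≥ d₁ ≥ ⋯ ≥ d_r ≥ 1, equipped with the standard nondegenerate R-bilinear pairing g·h = Σ_i p^{d−d_i} g_i h_i ∈ R. For each n, define G_tr ⊆ (G × G)^n as the set of tuples (𝐠₁,…,𝐠_n) = ((g_k,h_k))_{k=1}^n such that (g_k − g_l)·(h_k − h_l) = 0 for all k, l ∈ [n]. Then lim_{n→∞} |G_tr|/|G|^{n+1} = Σ_{H ≤ G} |∧²H|, where the sum ranges over all subgroups H of G. -/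
open Filter
open scoped Topology TensorProduct

/-- The finite abelian `p`-group `ℤ/p^{d₁} × ⋯ × ℤ/p^{d_r}`. -/
abbrev PGrp (p : ℕ) {r : ℕ} (dd : Fin r → ℕ) : Type := (i : Fin r) → ZMod (p ^ dd i)

/-- The standard `R`-bilinear pairing `g · h = Σ_i p^{d - d_i} g_i h_i ∈ ℤ/p^d`. -/
def dotPairing (p d : ℕ) {r : ℕ} (dd : Fin r → ℕ) (g h : PGrp p dd) : ZMod (p ^ d) :=
  ∑ i : Fin r,
    (p : ZMod (p ^ d)) ^ (d - dd i) * ((g i).val : ZMod (p ^ d)) * ((h i).val : ZMod (p ^ d))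

/-- The exterior square `∧² G`. -/
abbrev exteriorSquare (G : Type) [AddCommGroup G] : Type :=
  (G ⊗[ℤ] G) ⧸ Submodule.span ℤ {x : G ⊗[ℤ] G | ∃ g : G, x = g ⊗ₜ[ℤ] g}

theorem hasEnoughRootsOfUnity_multiplicative_zmod (m : ℕ) [NeZero m] :
    HasEnoughRootsOfUnity (Multiplicative (ZMod m)) m where
  prim := ⟨Multiplicative.ofAdd 1, by
    rw [IsPrimitiveRoot.iff_orderOf, orderOf_ofAdd_eq_addOrderOf, ZMod.addOrderOf_one]⟩
  cyc := by
    have : IsCyclic (Multiplicative (ZMod m))ˣ :=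
      isCyclic_of_surjective (toUnits (G := Multiplicative (ZMod m))) toUnits.surjective
    infer_instance

theorem hasEnoughRootsOfUnity_exponent {A : Type*} [AddCommGroup A] (m : ℕ) [NeZero m]
    (hA : ∀ a : A, m • a = 0) :
    HasEnoughRootsOfUnity (Multiplicative (ZMod m)) (Monoid.exponent (Multiplicative A)) := by
  have := hasEnoughRootsOfUnity_multiplicative_zmod m
  exact this.of_dvd _ (Monoid.exponent_dvd_of_forall_pow_eq_one fun a ↦ hA a)

/-- A finite abelian group killed by `m` has as many elements as its `ℤ/m`-dual. -/
theorem natCard_addMonoidHom_zmod {A : Type*} [AddCommGroup A] [Finite A] (m : ℕ) [NeZero m]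
    (hA : ∀ a : A, m • a = 0) : Nat.card (A →+ ZMod m) = Nat.card A := by
  have := hasEnoughRootsOfUnity_exponent m hA
  have h := CommGroup.card_monoidHom_of_hasEnoughRootsOfUnity (Multiplicative A)
    (Multiplicative (ZMod m))
  rw [Nat.card_congr (AddMonoidHom.toMultiplicative (α := A) (β := ZMod m)),
    Nat.card_congr (toUnits (G := Multiplicative (ZMod m))).monoidHomCongrRight.toEquiv, h]
  rfl

theorem exists_extension_zmod {A : Type*} [AddCommGroup A] [Finite A] (m : ℕ) [NeZero m]
    (hA : ∀ a : A, m • a = 0) (H : AddSubgroup A) (f : H →+ ZMod m) :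
    ∃ F : A →+ ZMod m, ∀ h : H, F h = f h := by
  have := hasEnoughRootsOfUnity_exponent m hA
  obtain ⟨F, hF⟩ := MonoidHom.domRestrict_surjective (M := Multiplicative (ZMod m))
    (AddSubgroup.toSubgroup H)
    ((toUnits (G := Multiplicative (ZMod m))).toMonoidHom.comp (AddMonoidHom.toMultiplicative f))
  refine ⟨AddMonoidHom.toMultiplicative.symm
    ((toUnits (G := Multiplicative (ZMod m))).symm.toMonoidHom.comp F), fun h ↦ ?_⟩
  have := congrArg (toUnits (G := Multiplicative (ZMod m))).symm
    (DFunLike.congr_fun hF (⟨Multiplicative.ofAdd h.1, h.2⟩ : AddSubgroup.toSubgroup H))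
  exact this

section Exterior

variable {H : Type} [AddCommGroup H]

theorem nsmul_exteriorSquare_eq_zero {m : ℕ} (hH : ∀ a : H, m • a = 0) (x : exteriorSquare H) :
    m • x = 0 := by
  obtain ⟨y, rfl⟩ := Submodule.Quotient.mk_surjective _ x
  have : m • y = 0 := by
    induction y with
    | zero => simp
    | tmul a b => rw [TensorProduct.smul_tmul', hH, TensorProduct.zero_tmul]
    | add a b ha hb => rw [smul_add, ha, hb, add_zero]
  rw [← Submodule.Quotient.mk_smul, this, Submodule.Quotient.mk_zero]

theorem finite_exteriorSquare [Finite H] : Finite (exteriorSquare H) := by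
  have : Module.Finite ℤ H := Module.Finite.of_finite
  have : Module.Finite ℤ (H ⊗[ℤ] H) := Module.Finite.tensorProduct ℤ H H
  have : Module.Finite ℤ (exteriorSquare H) :=
    Module.Finite.of_surjective (Submodule.mkQ _) (Submodule.mkQ_surjective _)
  refine Module.finite_of_fg_torsion (exteriorSquare H) fun x ↦ ?_
  refine ⟨⟨Nat.card H, mem_nonZeroDivisors_of_ne_zero (Nat.cast_ne_zero.2 Nat.card_pos.ne')⟩, ?_⟩
  have := nsmul_exteriorSquare_eq_zero (fun _ ↦ card_nsmul_eq_zero') x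
  rwa [← Nat.cast_smul_eq_nsmul ℤ] at this

/-- Homomorphisms out of the exterior square are alternating bilinear maps. -/
noncomputable def alternatingEquiv (T : Type*) [AddCommGroup T] :
    {B : H →ₗ[ℤ] H →ₗ[ℤ] T // ∀ h, B h h = 0} ≃ (exteriorSquare H →ₗ[ℤ] T) where
  toFun B := Submodule.liftQ _ (TensorProduct.lift B.1) (by
    rw [Submodule.span_le]
    rintro _ ⟨g, rfl⟩
    exact (TensorProduct.lift.tmul g g).trans (B.2 g))
  invFun f := ⟨(TensorProduct.mk ℤ H H).compr₂ (f.comp (Submodule.mkQ _)), fun h ↦ by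
    have : (Submodule.Quotient.mk (h ⊗ₜ[ℤ] h) : exteriorSquare H) = 0 :=
      (Submodule.Quotient.mk_eq_zero _).2 (Submodule.subset_span ⟨h, rfl⟩)
    exact (congrArg f this).trans (map_zero f)⟩
  left_inv B := by
    ext a b
    exact TensorProduct.lift.tmul a b
  right_inv f := by
    refine Submodule.linearMap_qext _ (TensorProduct.ext' fun a b ↦ ?_)
    exact TensorProduct.lift.tmul a b

theorem natCard_alternating [Finite H] {m : ℕ} [NeZero m] (hH : ∀ a : H, m • a = 0) :
    Nat.card {B : H →ₗ[ℤ] H →ₗ[ℤ] ZMod m // ∀ h, B h h = 0} = Nat.card (exteriorSquare H) := by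
  have := finite_exteriorSquare (H := H)
  rw [← natCard_addMonoidHom_zmod m (nsmul_exteriorSquare_eq_zero hH)]
  exact Nat.card_congr ((alternatingEquiv (ZMod m)).trans
    (addMonoidHomLequivInt ℤ).toEquiv.symm)

end Exterior

section Lagrangian

variable {G T : Type*} [AddCommGroup G] [AddCommGroup T] (β : G →+ G →+ T)

/-- The subgroup of elements pairing to zero with `H`. -/
def orthogonal (H : AddSubgroup G) : AddSubgroup G where
  carrier := {x | ∀ h ∈ H, β x h = 0}
  zero_mem' := by simp
  add_mem' ha hb h hh := by simp [ha h hh, hb h hh]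
  neg_mem' ha h hh := by simp [ha h hh]

/-- The quadratic form `(h, x) ↦ x · h` vanishes on `W`. -/
def IsIsotropic (W : AddSubgroup (G × G)) : Prop := ∀ v ∈ W, β v.2 v.1 = 0

/-- The fibre over `0` of the first projection of `W`. -/
def verticalPart (W : AddSubgroup (G × G)) : AddSubgroup G := W.comap (AddMonoidHom.inr G G)

/-- The first projection of `W`. -/
def firstProj (W : AddSubgroup (G × G)) : AddSubgroup G := W.map (AddMonoidHom.fst G G)

theorem mem_firstProj {W : AddSubgroup (G × G)} {h : G} :
    h ∈ firstProj W ↔ ∃ x, (h, x) ∈ W := by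
  simp [firstProj, AddSubgroup.mem_map]

theorem natCard_firstProj_mul_verticalPart (W : AddSubgroup (G × G)) :
    Nat.card (firstProj W) * Nat.card (verticalPart W) = Nat.card W := by
  let f : W →+ G := (AddMonoidHom.fst G G).comp W.subtype
  have h₁ : f.range = firstProj W := by
    rw [AddMonoidHom.range_comp, AddSubgroup.range_subtype, firstProj]
  have h₂ : Nat.card f.ker = Nat.card (verticalPart W) :=
    Nat.card_congr
      { toFun := fun w ↦ ⟨w.1.1.2, by
          have hw : w.1.1.1 = 0 := w.2
          change ((0 : G), w.1.1.2) ∈ W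
          rw [← hw]
          exact w.1.2⟩
        invFun := fun x ↦ ⟨⟨(0, x.1), x.2⟩, rfl⟩
        left_inv := fun w ↦ by
          have hw : w.1.1.1 = 0 := w.2
          ext
          · exact hw.symm
          · rfl
        right_inv := fun x ↦ rfl }
  rw [← h₁, ← h₂, ← AddSubgroup.index_ker, mul_comm, AddSubgroup.card_mul_index]

variable {β}

theorem IsIsotropic.polar {W : AddSubgroup (G × G)} (hW : IsIsotropic β W) {v w : G × G}
    (hv : v ∈ W) (hw : w ∈ W) : β v.2 w.1 + β w.2 v.1 = 0 := by
  have h := hW _ (W.add_mem hv hw)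
  simpa [hW v hv, hW w hw, add_comm] using h

theorem IsIsotropic.verticalPart_le {W : AddSubgroup (G × G)} (hW : IsIsotropic β W) :
    verticalPart W ≤ orthogonal β (firstProj W) := by
  intro y hy h hh
  obtain ⟨x, hx⟩ := mem_firstProj.1 hh
  simpa using hW.polar (v := (0, y)) hy hx

theorem IsIsotropic.natCard_le [Finite G]
    (hperp : ∀ H : AddSubgroup G, Nat.card H * Nat.card (orthogonal β H) = Nat.card G)
    {W : AddSubgroup (G × G)} (hW : IsIsotropic β W) : Nat.card W ≤ Nat.card G := by
  rw [← natCard_firstProj_mul_verticalPart, ← hperp (firstProj W)]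
  exact Nat.mul_le_mul_left _ (AddSubgroup.card_le_of_le hW.verticalPart_le)

variable (β) in
/-- The subgroup of `G × G` attached to a bilinear form `B` on a subgroup `H`. -/
def formSubgroup {H : AddSubgroup G} (B : H →ₗ[ℤ] H →ₗ[ℤ] T) : AddSubgroup (G × G) where
  carrier := {v | ∃ hv : v.1 ∈ H, ∀ h : H, β v.2 h = B ⟨v.1, hv⟩ h}
  zero_mem' := ⟨H.zero_mem, fun h ↦ by
    have : (⟨(0 : G × G).1, H.zero_mem⟩ : H) = 0 := rfl
    rw [this]
    simp⟩
  add_mem' := by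
    rintro a b ⟨ha, ha'⟩ ⟨hb, hb'⟩
    refine ⟨H.add_mem ha hb, fun h ↦ ?_⟩
    have : (⟨(a + b).1, H.add_mem ha hb⟩ : H) = ⟨a.1, ha⟩ + ⟨b.1, hb⟩ := rfl
    rw [this, map_add, LinearMap.add_apply, ← ha', ← hb']
    simp
  neg_mem' := by
    rintro a ⟨ha, ha'⟩
    refine ⟨H.neg_mem ha, fun h ↦ ?_⟩
    have : (⟨(-a).1, H.neg_mem ha⟩ : H) = -⟨a.1, ha⟩ := rfl
    rw [this, map_neg, LinearMap.neg_apply, ← ha']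
    simp

theorem firstProj_formSubgroup
    (hext : ∀ (H : AddSubgroup G) (f : H →+ T), ∃ x, ∀ h : H, β x h = f h)
    {H : AddSubgroup G} (B : H →ₗ[ℤ] H →ₗ[ℤ] T) : firstProj (formSubgroup β B) = H := by
  ext h
  rw [mem_firstProj]
  refine ⟨fun ⟨x, hx, _⟩ ↦ hx, fun hh ↦ ?_⟩
  obtain ⟨x, hx⟩ := hext H (B ⟨h, hh⟩).toAddMonoidHom
  exact ⟨x, hh, hx⟩

theorem verticalPart_formSubgroup {H : AddSubgroup G} (B : H →ₗ[ℤ] H →ₗ[ℤ] T) :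
    verticalPart (formSubgroup β B) = orthogonal β H := by
  ext x
  have h0 : (⟨0, H.zero_mem⟩ : H) = 0 := rfl
  constructor
  · rintro ⟨h, hx⟩ k hk
    simpa [h0] using hx ⟨k, hk⟩
  · intro hx
    exact ⟨H.zero_mem, fun h ↦ by simpa [h0] using hx h h.2⟩

theorem isIsotropic_formSubgroup {H : AddSubgroup G} {B : H →ₗ[ℤ] H →ₗ[ℤ] T}
    (hB : ∀ h, B h h = 0) : IsIsotropic β (formSubgroup β B) := by
  rintro v ⟨hv, h⟩
  rw [← hB ⟨v.1, hv⟩, ← h]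

theorem formSubgroup_injective
    (hext : ∀ (H : AddSubgroup G) (f : H →+ T), ∃ x, ∀ h : H, β x h = f h) {H : AddSubgroup G} :
    Function.Injective (formSubgroup β : (H →ₗ[ℤ] H →ₗ[ℤ] T) → _) := by
  intro B B' hBB
  ext h k
  obtain ⟨x, hx⟩ := hext H (B h).toAddMonoidHom
  have hmem : ((h : G), x) ∈ formSubgroup β B := ⟨h.2, hx⟩
  rw [hBB] at hmem
  obtain ⟨_, hx'⟩ := hmem
  exact (hx k).symm.trans (hx' k)

theorem IsIsotropic.exists_le_formSubgroup {W : AddSubgroup (G × G)} (hW : IsIsotropic β W) :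
    ∃ B : firstProj W →ₗ[ℤ] firstProj W →ₗ[ℤ] T, (∀ h, B h h = 0) ∧ W ≤ formSubgroup β B := by
  choose s hs using fun h : firstProj W ↦ mem_firstProj.1 h.2
  have key {x y h k : G} (hx : (h, x) ∈ W) (hy : (h, y) ∈ W) (hk : k ∈ firstProj W) :
      β x k = β y k := by
    have : x - y ∈ verticalPart W := by simpa [verticalPart] using W.sub_mem hx hy
    simpa [sub_eq_zero] using hW.verticalPart_le this k hk
  let B : firstProj W →+ firstProj W →+ T :=
    { toFun := fun h ↦ (β (s h)).comp (firstProj W).subtype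
      map_zero' := by
        ext k
        simpa using key (hs 0) W.zero_mem k.2
      map_add' := fun a b ↦ by
        ext k
        simpa using key (hs (a + b)) (W.add_mem (hs a) (hs b)) k.2 }
  refine ⟨((addMonoidHomLequivInt ℤ).toAddMonoidHom.comp B).toIntLinearMap, fun h ↦ hW _ (hs h), ?_⟩
  intro v hv
  have hv1 : v.1 ∈ firstProj W := mem_firstProj.2 ⟨v.2, hv⟩
  exact ⟨hv1, fun k ↦ key hv (hs ⟨v.1, hv1⟩) k.2⟩

/-- Maximal isotropic subgroups of `G × G` are parametrised by a subgroup of `G` together with an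
alternating form on it. -/
theorem natCard_lagrangian [Finite G]
    (hext : ∀ (H : AddSubgroup G) (f : H →+ T), ∃ x, ∀ h : H, β x h = f h)
    (hperp : ∀ H : AddSubgroup G, Nat.card H * Nat.card (orthogonal β H) = Nat.card G) :
    Nat.card {W : AddSubgroup (G × G) // IsIsotropic β W ∧ Nat.card W = Nat.card G} =
      Nat.card (Σ H : AddSubgroup G, {B : H →ₗ[ℤ] H →ₗ[ℤ] T // ∀ h, B h h = 0}) := by
  have hcard {H : AddSubgroup G} (B : H →ₗ[ℤ] H →ₗ[ℤ] T) :
      Nat.card (formSubgroup β B) = Nat.card G := by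
    rw [← natCard_firstProj_mul_verticalPart, firstProj_formSubgroup hext,
      verticalPart_formSubgroup, hperp]
  symm
  refine Nat.card_congr (Equiv.ofBijective
    (fun B ↦ ⟨formSubgroup β B.2.1, isIsotropic_formSubgroup B.2.2, hcard _⟩) ⟨?_, ?_⟩)
  · rintro ⟨H, B, hB⟩ ⟨H', B', hB'⟩ h
    replace h : formSubgroup β B = formSubgroup β B' := congrArg Subtype.val h
    obtain rfl : H = H' := by
      rw [← firstProj_formSubgroup hext B, h, firstProj_formSubgroup hext B']
    obtain rfl := formSubgroup_injective hext h
    rfl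
  · rintro ⟨W, hW, hWc⟩
    obtain ⟨B, hB, hle⟩ := hW.exists_le_formSubgroup
    refine ⟨⟨_, B, hB⟩, Subtype.ext ?_⟩
    exact (AddSubgroup.eq_of_le_of_card_ge hle (by rw [hcard, hWc])).symm

theorem isIsotropic_closure_range_iff {ι : Type*} {w : ι → G × G} :
    IsIsotropic β (AddSubgroup.closure (Set.range w)) ↔
      (∀ k, β (w k).2 (w k).1 = 0) ∧ ∀ k l, β (w k - w l).2 (w k - w l).1 = 0 := by
  have hmem k : w k ∈ AddSubgroup.closure (Set.range w) := AddSubgroup.subset_closure ⟨k, rfl⟩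
  refine ⟨fun h ↦ ⟨fun k ↦ h _ (hmem k), fun k l ↦ h _ (sub_mem (hmem k) (hmem l))⟩, ?_⟩
  rintro ⟨h₁, h₂⟩ v hv
  have hpol k l : β (w k).2 (w l).1 + β (w l).2 (w k).1 = 0 := by
    have := h₂ k l
    simp only [Prod.snd_sub, Prod.fst_sub, map_sub, AddMonoidHom.sub_apply, h₁] at this
    rw [← neg_eq_zero, ← this]
    abel
  have hpol' {v : G × G} (hv : v ∈ AddSubgroup.closure (Set.range w)) :
      ∀ l, β v.2 (w l).1 + β (w l).2 v.1 = 0 := by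
    intro l
    induction hv using AddSubgroup.closure_induction with
    | mem x hx => obtain ⟨k, rfl⟩ := hx; exact hpol k l
    | zero => simp
    | add x y _ _ hx hy =>
      simp only [Prod.snd_add, Prod.fst_add, map_add, AddMonoidHom.add_apply]
      rw [add_add_add_comm, hx, hy, add_zero]
    | neg x _ hx =>
      simp only [Prod.snd_neg, Prod.fst_neg, map_neg, AddMonoidHom.neg_apply]
      rw [← neg_add, hx, neg_zero]
  have hpol'' {u v : G × G} (hu : u ∈ AddSubgroup.closure (Set.range w))
      (hv : v ∈ AddSubgroup.closure (Set.range w)) : β u.2 v.1 + β v.2 u.1 = 0 := by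
    induction hv using AddSubgroup.closure_induction with
    | mem x hx => obtain ⟨k, rfl⟩ := hx; exact hpol' hu k
    | zero => simp
    | add x y _ _ hx hy =>
      simp only [Prod.snd_add, Prod.fst_add, map_add, AddMonoidHom.add_apply]
      rw [add_add_add_comm, hx, hy, add_zero]
    | neg x _ hx =>
      simp only [Prod.snd_neg, Prod.fst_neg, map_neg, AddMonoidHom.neg_apply]
      rw [← neg_add, hx, neg_zero]
  induction hv using AddSubgroup.closure_induction with
  | mem x hx => obtain ⟨k, rfl⟩ := hx; exact h₁ k
  | zero => simp
  | add x y hx hy hx' hy' =>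
    have := hpol'' hx hy
    simpa [hx', hy', add_comm] using this
  | neg x _ hx => simpa using hx

end Lagrangian

section Counting

variable {V : Type*} [AddCommGroup V]

/-- The number of `n`-tuples in `V` generating `W`. -/
noncomputable def generatingTuples (W : AddSubgroup V) (n : ℕ) : ℕ :=
  Nat.card {w : Fin n → V // AddSubgroup.closure (Set.range w) = W}

theorem natCard_closure_eq_sum [Finite V] [Fintype (AddSubgroup V)] (P : AddSubgroup V → Prop)
    [DecidablePred P] (n : ℕ) :
    Nat.card {w : Fin n → V // P (AddSubgroup.closure (Set.range w))} =
      ∑ W with P W, generatingTuples W n := by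
  classical
  have := Fintype.ofFinite V
  simp only [generatingTuples, Nat.card_eq_fintype_card, Fintype.card_subtype]
  rw [Finset.card_eq_sum_card_fiberwise (f := fun w ↦ AddSubgroup.closure (Set.range w))
    (t := Finset.univ.filter P) (fun w hw ↦ by simpa using hw)]
  refine Finset.sum_congr rfl fun W hW ↦ ?_
  congr 1
  ext w
  simp only [Finset.mem_filter, Finset.mem_univ, true_and, and_iff_right_iff_imp] at hW ⊢
  rintro rfl
  exact hW

theorem natCard_tuples_mem (W : AddSubgroup V) (n : ℕ) :
    Nat.card {w : Fin n → V // AddSubgroup.closure (Set.range w) ≤ W} = Nat.card W ^ n := by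
  rw [← Nat.card_fin n, ← Nat.card_fun, Nat.card_fin]
  refine Nat.card_congr ((Equiv.subtypeEquivRight fun w ↦ ?_).trans
    (Equiv.subtypePiEquivPi (p := fun _ x ↦ x ∈ W)))
  rw [AddSubgroup.closure_le, Set.range_subset_iff]
  rfl

variable [Finite V]

theorem generatingTuples_le (W : AddSubgroup V) (n : ℕ) :
    generatingTuples W n ≤ Nat.card W ^ n := by
  rw [← natCard_tuples_mem]
  exact Nat.card_le_card_of_injective (fun w ↦ ⟨w.1, w.2.le⟩) fun a b h ↦ by
    simpa [Subtype.ext_iff] using h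

theorem tendsto_generatingTuples_of_lt {W : AddSubgroup V} {N : ℕ} (hW : Nat.card W < N) :
    Tendsto (fun n ↦ (generatingTuples W n : ℝ) / (N : ℝ) ^ n) atTop (𝓝 0) := by
  have hN : (0 : ℝ) < N := by exact_mod_cast (Nat.zero_le _).trans_lt hW
  have h := tendsto_pow_atTop_nhds_zero_of_lt_one (r := (Nat.card W : ℝ) / N) (by positivity)
    (by rw [div_lt_one hN]; exact_mod_cast hW)
  refine squeeze_zero (fun n ↦ by positivity) (fun n ↦ ?_) h
  rw [div_pow]
  gcongr
  exact_mod_cast generatingTuples_le W n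

theorem tendsto_generatingTuples (W : AddSubgroup V) :
    Tendsto (fun n ↦ (generatingTuples W n : ℝ) / (Nat.card W : ℝ) ^ n) atTop (𝓝 1) := by
  classical
  have := Fintype.ofFinite (AddSubgroup V)
  have hlt : Tendsto (fun n ↦ ∑ U with U < W, (generatingTuples U n : ℝ) / (Nat.card W : ℝ) ^ n)
      atTop (𝓝 0) := by
    rw [← Finset.sum_const_zero (s := Finset.univ.filter fun U ↦ U < W)]
    refine tendsto_finsetSum _ fun U hU ↦ tendsto_generatingTuples_of_lt ?_
    have hU := (Finset.mem_filter.1 hU).2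
    refine lt_of_le_of_ne (AddSubgroup.card_le_of_le hU.le) fun h ↦ hU.ne ?_
    exact AddSubgroup.eq_of_le_of_card_ge hU.le h.ge
  refine (by simpa using hlt.const_sub (1 : ℝ) : Tendsto _ _ (𝓝 (1 : ℝ))).congr fun n ↦ ?_
  have hpos : (0 : ℝ) < (Nat.card W : ℝ) ^ n := by
    have : 0 < Nat.card W := Nat.card_pos
    positivity
  have h := natCard_closure_eq_sum (· ≤ W) n
  have hset : Finset.univ.filter (· ≤ W) = insert W (Finset.univ.filter fun U ↦ U < W) := by
    ext U
    simp [le_iff_eq_or_lt]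
  rw [natCard_tuples_mem, hset, Finset.sum_insert (by simp)] at h
  rw [← Finset.sum_div, sub_eq_iff_eq_add, ← add_div, eq_div_iff hpos.ne', one_mul]
  exact_mod_cast h

/-- If all subgroups satisfying `P` have order at most `N`, the number of `n`-tuples generating such
a subgroup is asymptotically `N ^ n` times the number of those of order exactly `N`. -/
theorem tendsto_natCard_closure (P : AddSubgroup V → Prop) {N : ℕ}
    (hP : ∀ W, P W → Nat.card W ≤ N) :
    Tendsto (fun n ↦ (Nat.card {w : Fin n → V // P (AddSubgroup.closure (Set.range w))} : ℝ) /
      (N : ℝ) ^ n) atTop (𝓝 (Nat.card {W : AddSubgroup V // P W ∧ Nat.card W = N} : ℝ)) := by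
  classical
  have := Fintype.ofFinite (AddSubgroup V)
  have hlim : (Nat.card {W : AddSubgroup V // P W ∧ Nat.card W = N} : ℝ) =
      ∑ W with P W, if Nat.card W = N then 1 else 0 := by
    rw [Finset.sum_boole, Finset.filter_filter, Nat.card_eq_fintype_card, Fintype.card_subtype]
  rw [hlim]
  simp only [natCard_closure_eq_sum, Nat.cast_sum, Finset.sum_div]
  refine tendsto_finsetSum _ fun W hW ↦ ?_
  split_ifs with h
  · simpa [h] using tendsto_generatingTuples W
  · exact tendsto_generatingTuples_of_lt (lt_of_le_of_ne (hP W (Finset.mem_filter.1 hW).2) h)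

end Counting

/-- Tuples with all differences satisfying `Q` are translates of tuples starting at `0`. -/
theorem natCard_tuples_succ {V : Type*} [AddCommGroup V] (Q : V → Prop) (h0 : Q 0)
    (hneg : ∀ v, Q v → Q (-v)) (n : ℕ) :
    Nat.card {v : Fin (n + 1) → V // ∀ k l, Q (v k - v l)} =
      Nat.card V * Nat.card {w : Fin n → V // (∀ k, Q (w k)) ∧ ∀ k l, Q (w k - w l)} := by
  rw [← Nat.card_prod]
  refine Nat.card_congr
    { toFun := fun v ↦ ⟨v.1 0, fun k ↦ v.1 k.succ - v.1 0, fun k ↦ v.2 _ _, fun k l ↦ ?_⟩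
      invFun := fun a ↦ ⟨Fin.cons a.1 fun k ↦ a.2.1 k + a.1, ?_⟩
      left_inv := fun v ↦ ?_
      right_inv := fun a ↦ ?_ }
  · simpa using v.2 k.succ l.succ
  · intro k l
    obtain ⟨x, w, hw, hw'⟩ := a
    cases k using Fin.cases <;> cases l using Fin.cases
    · simpa using h0
    · simpa using hneg _ (hw _)
    · simpa using hw _
    · simpa using hw' _ _
  · ext1
    funext k
    cases k using Fin.cases <;> simp
  · ext <;> simp

section Pairing

variable {m : ℕ} [NeZero m] {G : Type*} [AddCommGroup G] [Finite G] {β : G →+ G →+ ZMod m}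

theorem exists_apply_eq_of_nondegenerate (hG : ∀ a : G, m • a = 0)
    (hβ : ∀ x, (∀ h, β x h = 0) → x = 0) (H : AddSubgroup G) (f : H →+ ZMod m) :
    ∃ x, ∀ h : H, β x h = f h := by
  have hinj : Function.Injective β := by
    rw [injective_iff_map_eq_zero]
    exact fun x hx ↦ hβ x fun h ↦ by rw [hx, AddMonoidHom.zero_apply]
  have : Finite (G →+ ZMod m) := DFunLike.finite _
  have hsurj := (hinj.bijective_of_nat_card_le (natCard_addMonoidHom_zmod m hG).le).2
  obtain ⟨F, hF⟩ := exists_extension_zmod m hG H f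
  obtain ⟨x, rfl⟩ := hsurj F
  exact ⟨x, hF⟩

theorem natCard_mul_orthogonal (hG : ∀ a : G, m • a = 0)
    (hβ : ∀ x, (∀ h, β x h = 0) → x = 0) (H : AddSubgroup G) :
    Nat.card H * Nat.card (orthogonal β H) = Nat.card G := by
  let f : G →+ (H →+ ZMod m) := (AddMonoidHom.compHom' H.subtype).comp β
  have hf : f.range = ⊤ := AddMonoidHom.range_eq_top.2 fun φ ↦ by
    obtain ⟨x, hx⟩ := exists_apply_eq_of_nondegenerate hG hβ H φ
    exact ⟨x, AddMonoidHom.ext hx⟩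
  have hk : f.ker = orthogonal β H := by
    ext x
    rw [AddMonoidHom.mem_ker, DFunLike.ext_iff]
    exact Subtype.forall
  have hH : ∀ a : H, m • a = 0 := fun a ↦ Subtype.ext (hG a)
  rw [← f.ker.card_mul_index, AddSubgroup.index_ker, hf, hk, AddSubgroup.card_top,
    natCard_addMonoidHom_zmod m hH, mul_comm]

end Pairing

section DotPairing

variable {p d r : ℕ} {dd : Fin r → ℕ}

theorem pow_sub_mul_natCast_eq_zero_iff (hp : p.Prime) {e : ℕ} (he : e ≤ d) (a : ℕ) :
    (p : ZMod (p ^ d)) ^ (d - e) * a = 0 ↔ (a : ZMod (p ^ e)) = 0 := by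
  rw [← Nat.cast_pow, ← Nat.cast_mul, ZMod.natCast_eq_zero_iff, ZMod.natCast_eq_zero_iff]
  nth_rewrite 1 [← Nat.sub_add_cancel he]
  rw [pow_add, Nat.mul_dvd_mul_iff_left (pow_pos hp.pos _)]

theorem pow_sub_mul_val_add (hp : p.Prime) {e : ℕ} (he : e ≤ d) (a b : ZMod (p ^ e)) :
    (p : ZMod (p ^ d)) ^ (d - e) * ((a + b).val : ZMod (p ^ d)) =
      (p : ZMod (p ^ d)) ^ (d - e) * (a.val : ZMod (p ^ d)) +
        (p : ZMod (p ^ d)) ^ (d - e) * (b.val : ZMod (p ^ d)) := by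
  have : NeZero (p ^ e) := ⟨(pow_pos hp.pos _).ne'⟩
  have hq : (p : ZMod (p ^ d)) ^ (d - e) * ((p ^ e : ℕ) : ZMod (p ^ d)) = 0 := by
    rw [pow_sub_mul_natCast_eq_zero_iff hp he, ZMod.natCast_self]
  rw [ZMod.val_add, ← mul_add, ← Nat.cast_add]
  conv_rhs => rw [← Nat.mod_add_div (a.val + b.val) (p ^ e), Nat.cast_add, Nat.cast_mul, mul_add,
    ← mul_assoc, hq, zero_mul, add_zero]

theorem dotPairing_comm (g h : PGrp p dd) : dotPairing p d dd g h = dotPairing p d dd h g :=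
  Finset.sum_congr rfl fun _ _ ↦ mul_right_comm _ _ _

theorem dotPairing_add_left (hp : p.Prime) (hdd : ∀ i, dd i ≤ d) (g g' h : PGrp p dd) :
    dotPairing p d dd (g + g') h = dotPairing p d dd g h + dotPairing p d dd g' h := by
  simp only [dotPairing, ← Finset.sum_add_distrib, Pi.add_apply, pow_sub_mul_val_add hp (hdd _),
    add_mul]

/-- The pairing `dotPairing` as a biadditive map. -/
def dotHom (hp : p.Prime) (hdd : ∀ i, dd i ≤ d) : PGrp p dd →+ PGrp p dd →+ ZMod (p ^ d) :=
  AddMonoidHom.mk'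
    (fun x ↦ AddMonoidHom.mk' (fun h ↦ dotPairing p d dd h x)
      fun g g' ↦ dotPairing_add_left hp hdd g g' x)
    fun x y ↦ by
      refine AddMonoidHom.ext fun h ↦ ?_
      change dotPairing p d dd h (x + y) = dotPairing p d dd h x + dotPairing p d dd h y
      simp only [dotPairing_comm h, dotPairing_add_left hp hdd]

theorem dotHom_nondegenerate (hp : p.Prime) (hdd1 : ∀ i, 1 ≤ dd i) (hdd : ∀ i, dd i ≤ d)
    (x : PGrp p dd) (hx : ∀ h, dotHom hp hdd x h = 0) : x = 0 := by
  funext i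
  have : NeZero (p ^ dd i) := ⟨(pow_pos hp.pos _).ne'⟩
  have : Fact (1 < p ^ dd i) := ⟨Nat.one_lt_pow (Nat.one_le_iff_ne_zero.1 (hdd1 i)) hp.one_lt⟩
  have h : dotPairing p d dd (Pi.single i 1) x = 0 := hx _
  rw [dotPairing, Finset.sum_eq_single i (fun j _ hj ↦ by simp [Pi.single_eq_of_ne hj]) (by simp),
    Pi.single_eq_same, ZMod.val_one, Nat.cast_one, mul_one,
    pow_sub_mul_natCast_eq_zero_iff hp (hdd i)] at h
  simpa using h

theorem nsmul_pGrp_eq_zero (hdd : ∀ i, dd i ≤ d) (a : PGrp p dd) : p ^ d • a = 0 := by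
  funext i
  rw [Pi.smul_apply, nsmul_eq_mul, (ZMod.natCast_eq_zero_iff _ _).2 (pow_dvd_pow p (hdd i)),
    zero_mul, Pi.zero_apply]

end DotPairing

/-- the limit of `|G_tr| / |G|^{n+1}` for the random graph model equals
`Σ_{H ≤ G} |∧² H|`. -/
theorem trivialPart_limit_graph
    (p d r : ℕ) [Fact p.Prime] (hd : 1 ≤ d) (dd : Fin r → ℕ)
    (hdd1 : ∀ i, 1 ≤ dd i) (hddd : ∀ i, dd i ≤ d) (hanti : Antitone dd) :
    Tendsto (fun n : ℕ =>
        (Nat.card {v : Fin n → PGrp p dd × PGrp p dd //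
          ∀ k l : Fin n,
            dotPairing p d dd ((v k).1 - (v l).1) ((v k).2 - (v l).2) = 0} : ℝ) /
          (Nat.card (PGrp p dd) : ℝ) ^ (n + 1)) atTop
      (𝓝 (∑' H : AddSubgroup (PGrp p dd), (Nat.card (exteriorSquare H) : ℝ))) := by
  have hp : p.Prime := Fact.out
  have : NeZero (p ^ d) := ⟨(pow_pos hp.pos _).ne'⟩
  have (i : Fin r) : NeZero (p ^ dd i) := ⟨(pow_pos hp.pos _).ne'⟩
  have : Finite (PGrp p dd) := Pi.finite
  have hG := nsmul_pGrp_eq_zero (p := p) hddd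
  let β := dotHom hp hddd
  have hβ := dotHom_nondegenerate hp hdd1 hddd
  have hperp := natCard_mul_orthogonal hG hβ
  have hlim := tendsto_natCard_closure (IsIsotropic β) fun W hW ↦ hW.natCard_le hperp
  have hsum : (Nat.card {W : AddSubgroup (PGrp p dd × PGrp p dd) //
      IsIsotropic β W ∧ Nat.card W = Nat.card (PGrp p dd)} : ℝ) =
      ∑' H : AddSubgroup (PGrp p dd), (Nat.card (exteriorSquare H) : ℝ) := by
    have := Fintype.ofFinite (AddSubgroup (PGrp p dd))
    have (H : AddSubgroup (PGrp p dd)) := finite_exteriorSquare (H := H)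
    have hcard (H : AddSubgroup (PGrp p dd)) :=
      natCard_alternating (m := p ^ d) (H := H) fun a ↦ Subtype.ext (hG a)
    have (H : AddSubgroup (PGrp p dd)) :
        Finite {B : H →ₗ[ℤ] H →ₗ[ℤ] ZMod (p ^ d) // ∀ h, B h h = 0} :=
      Nat.finite_of_card_ne_zero (by rw [hcard]; exact Nat.card_pos.ne')
    rw [natCard_lagrangian (exists_apply_eq_of_nondegenerate hG hβ) hperp, Nat.card_sigma,
      tsum_fintype, Nat.cast_sum]
    simp only [hcard]
  rw [← hsum, ← tendsto_add_atTop_iff_nat 1]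
  refine hlim.congr fun n ↦ ?_
  have hN : (Nat.card (PGrp p dd) : ℝ) ≠ 0 := Nat.cast_ne_zero.2 Nat.card_pos.ne'
  have hcount := natCard_tuples_succ (fun v : PGrp p dd × PGrp p dd ↦ β v.2 v.1 = 0) (by simp)
    (fun v hv ↦ by simpa using hv) n
  have hcount' : Nat.card {v : Fin (n + 1) → PGrp p dd × PGrp p dd // ∀ k l,
      dotPairing p d dd ((v k).1 - (v l).1) ((v k).2 - (v l).2) = 0} = _ := hcount
  rw [hcount', Nat.card_prod]
  simp only [isIsotropic_closure_range_iff]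
  push_cast
  field_simp
  ring
end

section
/- Let G be a finite abelian group and P: G × G → ℚ/ℤ a perfect bilinear pairing. Define the bilinear pairing B_Sym on G² = G × G by B_Sym((g,h),(g',h')) = P(g,h') + P(g',h). Call a subgroup W ≤ G² of P-vanishing type if P(g,h) = 0 for every (g,h) ∈ W. Then there is a bijection between the set of maximal isotropic subgroups of (G², B_Sym) of P-vanishing type (equivalently, isotropic subgroups W of P-vanishing type with |W| = |G|) and the set of pairs (H, β) where H ≤ G is a subgroup and β: H × H → ℚ/ℤ is an alternating bilinear pairing. In particular, their number equals Σ_{H ≤ G} |Hom(∧²H, ℚ/ℤ)|. -/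
open scoped TensorProduct

/-- The group `ℚ/ℤ`. -/
abbrev QmodZ : Type := ℚ ⧸ AddSubgroup.zmultiples (1 : ℚ)

theorem exists_injective_toUnitAddCircle :
    ∃ e : QmodZ →+ UnitAddCircle, Function.Injective e := by
  refine ⟨QuotientAddGroup.map _ _ (Rat.castHom ℝ : ℚ →+ ℝ) ?_, ?_⟩
  · rw [AddSubgroup.zmultiples_le]
    exact ⟨1, by simp⟩
  · rw [injective_iff_map_eq_zero]
    intro x hx
    obtain ⟨q, rfl⟩ := QuotientAddGroup.mk_surjective x
    rw [QuotientAddGroup.map_mk, QuotientAddGroup.eq_zero_iff] at hx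
    obtain ⟨n, hn⟩ := hx
    rw [QuotientAddGroup.eq_zero_iff]
    refine ⟨n, ?_⟩
    have h : (n : ℝ) = (q : ℝ) := by simpa using hn
    simpa using (by exact_mod_cast h : (n : ℚ) = q)

/-- Characters with values in `ℚ/ℤ` are complex characters. -/
theorem exists_injective_toAddChar (A : Type*) [AddCommGroup A] :
    ∃ f : (A →+ QmodZ) → AddChar A ℂ, Function.Injective f := by
  obtain ⟨e, he⟩ := exists_injective_toUnitAddCircle
  refine ⟨fun φ => ⟨fun a => (AddCircle.toCircle (e (φ a)) : ℂ), by simp,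
    fun a b => by simp [AddCircle.toCircle_add]⟩, fun φ ψ h => ?_⟩
  ext a
  have h' : (AddCircle.toCircle (e (φ a)) : ℂ) = AddCircle.toCircle (e (ψ a)) :=
    DFunLike.congr_fun h a
  exact he (AddCircle.injective_toCircle one_ne_zero (Subtype.coe_injective h'))

instance finite_hom_QmodZ (A : Type*) [AddCommGroup A] [Finite A] : Finite (A →+ QmodZ) :=
  Finite.of_injective _ (exists_injective_toAddChar A).choose_spec

theorem card_hom_QmodZ_le (A : Type*) [AddCommGroup A] [Finite A] :
    Nat.card (A →+ QmodZ) ≤ Nat.card A := by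
  cases nonempty_fintype A
  calc Nat.card (A →+ QmodZ) ≤ Nat.card (AddChar A ℂ) :=
        Nat.card_le_card_of_injective _ (exists_injective_toAddChar A).choose_spec
    _ = Nat.card A := by rw [Nat.card_eq_fintype_card, AddChar.card_eq, Nat.card_eq_fintype_card]

/-- `ℚ/ℤ`-valued characters separate points. -/
theorem eq_zero_of_hom_QmodZ_apply {A : Type*} [AddCommGroup A] {a : A}
    (h : ∀ φ : A →+ QmodZ, φ a = 0) : a = 0 :=
  CharacterModule.eq_zero_of_character_apply fun c => h c

theorem card_hom_QmodZ (A : Type*) [AddCommGroup A] [Finite A] :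
    Nat.card (A →+ QmodZ) = Nat.card A := by
  refine (card_hom_QmodZ_le A).antisymm (le_trans ?_ (card_hom_QmodZ_le (A →+ QmodZ)))
  refine Nat.card_le_card_of_injective (AddMonoidHom.eval : A →+ _) ?_
  rw [injective_iff_map_eq_zero]
  exact fun a ha => eq_zero_of_hom_QmodZ_apply fun φ => DFunLike.congr_fun ha φ

theorem exists_extend_hom_QmodZ {A : Type*} [AddCommGroup A] (H : AddSubgroup A)
    (χ : H →+ QmodZ) : ∃ ψ : A →+ QmodZ, ψ.comp H.subtype = χ := by
  obtain ⟨ψ, hψ⟩ := CharacterModule.dual_surjective_of_injective (R := ℤ)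
    H.subtype.toIntLinearMap H.subtype_injective χ
  exact ⟨ψ, hψ⟩

theorem card_ker_mul_card_of_surjective {A B : Type*} [AddCommGroup A] [AddCommGroup B]
    (f : A →+ B) (hf : Function.Surjective f) :
    Nat.card f.ker * Nat.card B = Nat.card A := by
  rw [AddSubgroup.card_eq_card_quotient_mul_card_addSubgroup f.ker, mul_comm,
    Nat.card_congr (QuotientAddGroup.quotientKerEquivOfSurjective f hf).toEquiv]

section PerfectPairing

variable {G : Type} [AddCommGroup G] (P : G →+ (G →+ QmodZ))

theorem flip_surjective_of_bijective [Finite G] (hP : Function.Bijective P) :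
    Function.Surjective P.flip := by
  refine ((Nat.bijective_iff_injective_and_card _).2 ⟨?_, (card_hom_QmodZ G).symm⟩).2
  rw [injective_iff_map_eq_zero]
  refine fun h hh => eq_zero_of_hom_QmodZ_apply fun φ => ?_
  obtain ⟨g, rfl⟩ := hP.2 φ
  exact DFunLike.congr_fun hh g

theorem flip_restrict_surjective_of_bijective [Finite G] (hP : Function.Bijective P)
    (H : AddSubgroup G) : Function.Surjective (P.comp H.subtype).flip := by
  intro χ
  obtain ⟨ψ, rfl⟩ := exists_extend_hom_QmodZ H χ
  obtain ⟨h, rfl⟩ := flip_surjective_of_bijective P hP ψ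
  exact ⟨h, rfl⟩

/-- The homomorphism `(g, h) ↦ P(·, h)|_H - β(g, ·)`. -/
def pairingDefect {H : AddSubgroup G} (β : H →+ (H →+ QmodZ)) : H × G →+ (H →+ QmodZ) :=
  (P.comp H.subtype).flip.comp (AddMonoidHom.snd H G) - β.comp (AddMonoidHom.fst H G)

/-- The subgroup of all `(g, h)` with `g ∈ H` and `P(·, h)|_H = β(g, ·)`. -/
def subgroupOfPairing {H : AddSubgroup G} (β : H →+ (H →+ QmodZ)) : AddSubgroup (G × G) :=
  (pairingDefect P β).ker.map (H.subtype.prodMap (AddMonoidHom.id G))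

variable {P}

theorem mem_subgroupOfPairing {H : AddSubgroup G} {β : H →+ (H →+ QmodZ)} {w : G × G} :
    w ∈ subgroupOfPairing P β ↔
      ∃ hw : w.1 ∈ H, ∀ x : H, P x w.2 = β ⟨w.1, hw⟩ x := by
  rw [subgroupOfPairing, AddSubgroup.mem_map]
  constructor
  · rintro ⟨⟨g, h⟩, hg, rfl⟩
    exact ⟨g.2, fun x => sub_eq_zero.1 (DFunLike.congr_fun hg x)⟩
  · rintro ⟨hw, h⟩
    exact ⟨(⟨w.1, hw⟩, w.2), DFunLike.ext _ _ fun x => sub_eq_zero.2 (h x), rfl⟩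

theorem card_subgroupOfPairing [Finite G] (hP : Function.Bijective P) {H : AddSubgroup G}
    (β : H →+ (H →+ QmodZ)) : Nat.card (subgroupOfPairing P β) = Nat.card G := by
  have hinj : Function.Injective (H.subtype.prodMap (AddMonoidHom.id G)) :=
    H.subtype_injective.prodMap Function.injective_id
  rw [subgroupOfPairing, AddSubgroup.card_map_of_injective hinj]
  have hsurj : Function.Surjective (pairingDefect P β) := by
    intro χ
    obtain ⟨h, rfl⟩ := flip_restrict_surjective_of_bijective P hP H χ
    exact ⟨(0, h), by simp [pairingDefect]⟩
  have h := card_ker_mul_card_of_surjective _ hsurj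
  rw [card_hom_QmodZ, Nat.card_prod, mul_comm (Nat.card H)] at h
  exact Nat.eq_of_mul_eq_mul_right Nat.card_pos h

theorem exists_mem_subgroupOfPairing [Finite G] (hP : Function.Bijective P) {H : AddSubgroup G}
    (β : H →+ (H →+ QmodZ)) (g : H) : ∃ h : G, ((g : G), h) ∈ subgroupOfPairing P β := by
  obtain ⟨h, hh⟩ := flip_restrict_surjective_of_bijective P hP H (β g)
  exact ⟨h, mem_subgroupOfPairing.2 ⟨g.2, fun x => DFunLike.congr_fun hh x⟩⟩

theorem le_of_subgroupOfPairing_le [Finite G] (hP : Function.Bijective P) {H H' : AddSubgroup G}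
    {β : H →+ (H →+ QmodZ)} {β' : H' →+ (H' →+ QmodZ)}
    (h : subgroupOfPairing P β ≤ subgroupOfPairing P β') : H ≤ H' := by
  intro g hg
  obtain ⟨k, hk⟩ := exists_mem_subgroupOfPairing hP β ⟨g, hg⟩
  exact (mem_subgroupOfPairing.1 (h hk)).1

theorem alternating_add_swap {H : Type*} [AddCommGroup H] {β : H →+ (H →+ QmodZ)}
    (hβ : ∀ x, β x x = 0) (x y : H) : β x y + β y x = 0 := by
  simpa [hβ] using hβ (x + y)

theorem isotropic_subgroupOfPairing {H : AddSubgroup G} {β : H →+ (H →+ QmodZ)}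
    (hβ : ∀ x, β x x = 0) :
    ∀ w ∈ subgroupOfPairing P β, ∀ w' ∈ subgroupOfPairing P β, P w.1 w'.2 + P w'.1 w.2 = 0 := by
  intro w hw w' hw'
  obtain ⟨h, hh⟩ := mem_subgroupOfPairing.1 hw
  obtain ⟨h', hh'⟩ := mem_subgroupOfPairing.1 hw'
  exact (congrArg₂ (· + ·) (hh' ⟨_, h⟩) (hh ⟨_, h'⟩)).trans (alternating_add_swap hβ _ _)

theorem vanishing_subgroupOfPairing {H : AddSubgroup G} {β : H →+ (H →+ QmodZ)}
    (hβ : ∀ x, β x x = 0) : ∀ w ∈ subgroupOfPairing P β, P w.1 w.2 = 0 := by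
  intro w hw
  obtain ⟨h, hh⟩ := mem_subgroupOfPairing.1 hw
  exact (hh ⟨_, h⟩).trans (hβ _)

/-- Every isotropic subgroup of vanishing type lies in the subgroup attached to an alternating
pairing on its first projection. -/
theorem exists_le_subgroupOfPairing (W : AddSubgroup (G × G))
    (hiso : ∀ w ∈ W, ∀ w' ∈ W, P w.1 w'.2 + P w'.1 w.2 = 0)
    (hvan : ∀ w ∈ W, P w.1 w.2 = 0) :
    ∃ (H : AddSubgroup G) (β : H →+ (H →+ QmodZ)),
      (∀ x, β x x = 0) ∧ W ≤ subgroupOfPairing P β := by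
  have hex : ∀ g : W.map (AddMonoidHom.fst G G), ∃ k : G, ((g : G), k) ∈ W := by
    rintro ⟨_, ⟨g, k⟩, hw, rfl⟩
    exact ⟨k, hw⟩
  have hwd : ∀ {g k k' : G}, (g, k) ∈ W → (g, k') ∈ W →
      ∀ x : W.map (AddMonoidHom.fst G G), P x k = P x k' := by
    intro g k k' hk hk' x
    obtain ⟨l, hl⟩ := hex x
    have h₁ := hiso _ hl _ hk
    have h₂ := hiso _ hl _ hk'
    exact add_right_cancel (h₁.trans h₂.symm)
  choose s hs using hex
  refine ⟨_, AddMonoidHom.mk' (fun g => (P.comp (AddSubgroup.subtype _)).flip (s g)) ?_, ?_, ?_⟩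
  · intro a b
    ext x
    have h := hwd (hs (a + b)) (W.add_mem (hs a) (hs b)) x
    simpa using h
  · exact fun x => hvan _ (hs x)
  · rintro ⟨g, k⟩ hw
    refine mem_subgroupOfPairing.2 ⟨⟨_, hw, rfl⟩, fun x => ?_⟩
    exact hwd hw (hs ⟨g, _, hw, rfl⟩) x

end PerfectPairing

/-- The homomorphism on the exterior square induced by an alternating pairing. -/
def exteriorSquareLift {H : Type} [AddCommGroup H] (β : H →+ (H →+ QmodZ))
    (hβ : ∀ x, β x x = 0) : exteriorSquare H →+ QmodZ :=
  (Submodule.liftQ _ (TensorProduct.liftAddHom (R := ℤ) β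
    fun r m n => by simp).toIntLinearMap <| by
      rw [Submodule.span_le]
      rintro _ ⟨g, rfl⟩
      exact hβ g).toAddMonoidHom

/-- The pairing induced by a homomorphism on the exterior square. -/
def pairingOfExteriorSquareHom {H : Type} [AddCommGroup H] (φ : exteriorSquare H →+ QmodZ) :
    H →+ (H →+ QmodZ) :=
  AddMonoidHom.mk' (fun x => (φ.comp (Submodule.mkQ _).toAddMonoidHom).comp
    (TensorProduct.mk ℤ H H x).toAddMonoidHom) fun x y => by
      ext z
      simp

theorem pairingOfExteriorSquareHom_self {H : Type} [AddCommGroup H]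
    (φ : exteriorSquare H →+ QmodZ) (x : H) : pairingOfExteriorSquareHom φ x x = 0 := by
  have h : (Submodule.Quotient.mk (x ⊗ₜ[ℤ] x) : exteriorSquare H) = 0 :=
    (Submodule.Quotient.mk_eq_zero _).2 (Submodule.subset_span ⟨x, rfl⟩)
  exact (congrArg φ h).trans (map_zero φ)

theorem exteriorSquareHom_ext {H : Type} [AddCommGroup H] {φ ψ : exteriorSquare H →+ QmodZ}
    (h : pairingOfExteriorSquareHom φ = pairingOfExteriorSquareHom ψ) : φ = ψ := by
  refine DFunLike.ext _ _ fun q => ?_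
  obtain ⟨t, rfl⟩ := Submodule.Quotient.mk_surjective _ q
  induction t using TensorProduct.induction_on with
  | zero => exact (map_zero φ).trans (map_zero ψ).symm
  | tmul x y => exact DFunLike.congr_fun (DFunLike.congr_fun h x) y
  | add x y hx hy =>
    exact (map_add φ _ _).trans ((congrArg₂ (· + ·) hx hy).trans (map_add ψ _ _).symm)

/-- Alternating pairings on `H` are homomorphisms on the exterior square. -/
def alternatingEquivExteriorSquareHom (H : Type) [AddCommGroup H] :
    {β : H →+ (H →+ QmodZ) // ∀ x : H, β x x = 0} ≃ (exteriorSquare H →+ QmodZ) where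
  toFun β := exteriorSquareLift β.1 β.2
  invFun φ := ⟨pairingOfExteriorSquareHom φ, pairingOfExteriorSquareHom_self φ⟩
  left_inv _ := rfl
  right_inv _ := exteriorSquareHom_ext rfl

/-- The bijection from pairs `(H, β)` to maximal isotropic subgroups of vanishing type. -/
theorem nonempty_isotropic_equiv {G : Type} [AddCommGroup G] [Finite G]
    (P : G →+ (G →+ QmodZ)) (hP : Function.Bijective P) :
    Nonempty
      ({W : AddSubgroup (G × G) //
          (∀ w ∈ W, ∀ w' ∈ W, P w.1 w'.2 + P w'.1 w.2 = 0) ∧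
          (∀ w ∈ W, P w.1 w.2 = 0) ∧
          Nat.card W = Nat.card G} ≃
        ((H : AddSubgroup G) × {β : H →+ (H →+ QmodZ) // ∀ x : H, β x x = 0})) := by
  refine ⟨(Equiv.ofBijective (fun p => ⟨subgroupOfPairing P p.2.1,
    isotropic_subgroupOfPairing p.2.2, vanishing_subgroupOfPairing p.2.2,
    card_subgroupOfPairing hP _⟩) ⟨?_, ?_⟩).symm⟩
  · rintro ⟨H, β, hβ⟩ ⟨H', β', hβ'⟩ h
    have hW : subgroupOfPairing P β = subgroupOfPairing P β' := congrArg Subtype.val h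
    obtain rfl : H = H' :=
      (le_of_subgroupOfPairing_le hP hW.le).antisymm (le_of_subgroupOfPairing_le hP hW.ge)
    obtain rfl : β = β' := by
      ext x y
      obtain ⟨k, hk⟩ := exists_mem_subgroupOfPairing hP β x
      obtain ⟨_, h₁⟩ := mem_subgroupOfPairing.1 hk
      obtain ⟨_, h₂⟩ := mem_subgroupOfPairing.1 (hW ▸ hk)
      exact (h₁ y).symm.trans (h₂ y)
    rfl
  · rintro ⟨W, hiso, hvan, hcard⟩
    obtain ⟨H, β, hβ, hle⟩ := exists_le_subgroupOfPairing W hiso hvan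
    refine ⟨⟨H, β, hβ⟩, Subtype.ext ?_⟩
    exact (AddSubgroup.eq_of_le_of_card_ge hle
      ((card_subgroupOfPairing hP β).trans hcard.symm).le).symm

/-- for a perfect pairing `P : G × G → ℚ/ℤ` on a finite abelian group `G`,
the maximal isotropic subgroups of `(G², B_Sym)` of `P`-vanishing type (equivalently,
isotropic subgroups of `P`-vanishing type of cardinality `|G|`) are in bijection with pairs
`(H, β)` of a subgroup `H ≤ G` and an alternating bilinear pairing `β : H × H → ℚ/ℤ`; in
particular their number is `Σ_{H ≤ G} |Hom(∧² H, ℚ/ℤ)|`. -/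
theorem maximal_isotropic_BSym
    (G : Type) [AddCommGroup G] [Fintype G]
    (P : G →+ (G →+ QmodZ)) (hP : Function.Bijective P) :
    Nonempty
      ({W : AddSubgroup (G × G) //
          (∀ w ∈ W, ∀ w' ∈ W,
            P (Prod.fst w) (Prod.snd w') + P (Prod.fst w') (Prod.snd w) = 0) ∧
          (∀ w ∈ W, P (Prod.fst w) (Prod.snd w) = 0) ∧
          Nat.card W = Nat.card G} ≃
        ((H : AddSubgroup G) ×
          {β : H →+ (H →+ QmodZ) // ∀ x : H, β x x = 0})) ∧
    Nat.card {W : AddSubgroup (G × G) //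
        (∀ w ∈ W, ∀ w' ∈ W,
          P (Prod.fst w) (Prod.snd w') + P (Prod.fst w') (Prod.snd w) = 0) ∧
        (∀ w ∈ W, P (Prod.fst w) (Prod.snd w) = 0) ∧
        Nat.card W = Nat.card G} =
      Nat.card ((H : AddSubgroup G) × (exteriorSquare H →+ QmodZ)) := by
  obtain ⟨e⟩ := nonempty_isotropic_equiv P hP
  exact ⟨⟨e⟩, Nat.card_congr
    (e.trans (Equiv.sigmaCongrRight fun H => alternatingEquivExteriorSquareHom H))⟩
end
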